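/- Assume θ ≠ π/4 and θ ≠ 3π/4. Then: (i) D(x) > 0 for every x in the closed interval [√(1 − 2|c|s), √(1 + 2|c|s)]; (ii) W₊(x) > 0 and W₋(x) > 0 for every x in the open interval 𝒟 = (√(1 − 2|c|s), √(1 + 2|c|s)); (iii) W₊(√(1 − 2|c|s)) = 0 and W₋(√(1 + 2|c|s)) = 0. -/

import Mathlib

/-- `D(x) = 1 − 4c²s² + c²s²x²`. -/
noncomputable def Dfun (θ x : ℝ) : ℝ :=
  1 - 4 * Real.cos θ ^ 2 * Real.sin θ ^ 2 + Real.cos θ ^ 2 * Real.sin θ ^ 2 * x ^ 2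

/-- `W₊(x) = −2(1 − 2|c|s) + (1 − |c|s)x² + x√(D(x))`. -/
noncomputable def Wplus (θ x : ℝ) : ℝ :=
  -2 * (1 - 2 * |Real.cos θ| * Real.sin θ) + (1 - |Real.cos θ| * Real.sin θ) * x ^ 2 +
    x * Real.sqrt (Dfun θ x)

/-- `W₋(x) = 2(1 + 2|c|s) − (1 + |c|s)x² − x√(D(x))`. -/
noncomputable def Wminus (θ x : ℝ) : ℝ :=
  2 * (1 + 2 * |Real.cos θ| * Real.sin θ) - (1 + |Real.cos θ| * Real.sin θ) * x ^ 2 -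
    x * Real.sqrt (Dfun θ x)

theorem Dfun_eq_abs (θ x : ℝ) :
    Dfun θ x = 1 - 4 * (|Real.cos θ| * Real.sin θ) ^ 2 +
      (|Real.cos θ| * Real.sin θ) ^ 2 * x ^ 2 := by
  rw [Dfun, mul_pow, sq_abs]
  ring

theorem cos_ne_sqrt_two_div_two {θ : ℝ} (hθ : θ ∈ Set.Ioo 0 Real.pi)
    (hθ4 : θ ≠ Real.pi / 4) : Real.cos θ ≠ √2 / 2 := by
  rw [← Real.cos_pi_div_four]
  have := Real.pi_pos
  exact fun h => hθ4 (Real.injOn_cos ⟨hθ.1.le, hθ.2.le⟩ ⟨by linarith, by linarith⟩ h)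

theorem abs_cos_mul_sin_lt_half {θ : ℝ} (hθ : θ ∈ Set.Ioo 0 Real.pi)
    (hθ4 : θ ≠ Real.pi / 4) (hθ34 : θ ≠ 3 * Real.pi / 4) :
    |Real.cos θ| * Real.sin θ < 1 / 2 := by
  have hne : |Real.cos θ| ≠ √2 / 2 := by
    intro h
    rcases eq_or_eq_neg_of_abs_eq h with h | h
    · exact cos_ne_sqrt_two_div_two hθ hθ4 h
    · refine cos_ne_sqrt_two_div_two (θ := Real.pi - θ)
        ⟨by linarith [hθ.2], by linarith [hθ.1]⟩ (fun h' => hθ34 (by linarith)) ?_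
      rw [Real.cos_pi_sub, h, neg_neg]
  have hsub : |Real.cos θ| - Real.sin θ ≠ 0 := by
    intro h
    apply hne
    have h1 : |Real.cos θ| ^ 2 = (√2 / 2) ^ 2 := by
      rw [div_pow, Real.sq_sqrt zero_le_two]
      have h2 := Real.sin_sq_add_cos_sq θ
      rw [← sub_eq_zero.mp h, sq_abs] at h2
      rw [sq_abs]
      linarith
    exact (pow_left_inj₀ (abs_nonneg _) (by positivity) two_ne_zero).mp h1
  have h1 := Real.sin_sq_add_cos_sq θ
  rw [← sq_abs (Real.cos θ)] at h1
  nlinarith [sq_pos_of_ne_zero hsub]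

/-- If `θ ≠ π/4, 3π/4`, then (i) `D > 0` on the closed interval
`[√(1 − 2|c|s), √(1 + 2|c|s)]`; (ii) `W₊ > 0` and `W₋ > 0` on the open interval
`𝒟 = (√(1 − 2|c|s), √(1 + 2|c|s))`; (iii) `W₊` vanishes at the left endpoint and
`W₋` vanishes at the right endpoint. -/
theorem D_Wplus_Wminus_pos (θ : ℝ) (hθ : θ ∈ Set.Ioo 0 Real.pi) (hθ' : θ ≠ Real.pi / 2)
    (hθ4 : θ ≠ Real.pi / 4) (hθ34 : θ ≠ 3 * Real.pi / 4) :
    (∀ x ∈ Set.Icc (Real.sqrt (1 - 2 * |Real.cos θ| * Real.sin θ))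
        (Real.sqrt (1 + 2 * |Real.cos θ| * Real.sin θ)), 0 < Dfun θ x) ∧
    (∀ x ∈ Set.Ioo (Real.sqrt (1 - 2 * |Real.cos θ| * Real.sin θ))
        (Real.sqrt (1 + 2 * |Real.cos θ| * Real.sin θ)), 0 < Wplus θ x ∧ 0 < Wminus θ x) ∧
    Wplus θ (Real.sqrt (1 - 2 * |Real.cos θ| * Real.sin θ)) = 0 ∧
    Wminus θ (Real.sqrt (1 + 2 * |Real.cos θ| * Real.sin θ)) = 0 := by
  have ha : 0 ≤ |Real.cos θ| * Real.sin θ :=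
    mul_nonneg (abs_nonneg _) (Real.sin_pos_of_mem_Ioo hθ).le
  have ha2 := abs_cos_mul_sin_lt_half hθ hθ4 hθ34
  simp only [Wplus, Wminus, Dfun_eq_abs, mul_assoc (2 : ℝ)]
  generalize |Real.cos θ| * Real.sin θ = a at ha ha2 ⊢
  have hl : 0 ≤ 1 - 2 * a := by linarith
  have hr : 0 ≤ 1 + 2 * a := by linarith
  have hl2 := Real.sq_sqrt hl
  have hr2 := Real.sq_sqrt hr
  have hl0 := Real.sqrt_nonneg (1 - 2 * a)
  have hr0 := Real.sqrt_nonneg (1 + 2 * a)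
  have hDl : √(1 - 4 * a ^ 2 + a ^ 2 * √(1 - 2 * a) ^ 2) = (1 + a) * √(1 - 2 * a) := by
    rw [hl2, show 1 - 4 * a ^ 2 + a ^ 2 * (1 - 2 * a) = (1 + a) ^ 2 * (1 - 2 * a) by ring,
      Real.sqrt_mul (sq_nonneg _), Real.sqrt_sq (by linarith)]
  have hDr : √(1 - 4 * a ^ 2 + a ^ 2 * √(1 + 2 * a) ^ 2) = (1 - a) * √(1 + 2 * a) := by
    rw [hr2, show 1 - 4 * a ^ 2 + a ^ 2 * (1 + 2 * a) = (1 - a) ^ 2 * (1 + 2 * a) by ring,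
      Real.sqrt_mul (sq_nonneg _), Real.sqrt_sq (by linarith)]
  refine ⟨fun x _ => by nlinarith [mul_nonneg (sq_nonneg a) (sq_nonneg x)],
    fun x ⟨hlx, hxr⟩ => ?_, ?_, ?_⟩
  · have hx : 0 ≤ x := hl0.trans hlx.le
    have hlx2 : √(1 - 2 * a) ^ 2 < x ^ 2 := by gcongr
    have hxr2 : x ^ 2 < √(1 + 2 * a) ^ 2 := by gcongr
    have hmono {y z : ℝ} (hy : 0 ≤ y) (hyz : y ≤ z) :
        y * √(1 - 4 * a ^ 2 + a ^ 2 * y ^ 2) ≤ z * √(1 - 4 * a ^ 2 + a ^ 2 * z ^ 2) := by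
      gcongr
      exact hy.trans hyz
    have h1 := hmono hl0 hlx.le
    have h2 := hmono hx hxr.le
    rw [hDl] at h1
    rw [hDr] at h2
    constructor <;> nlinarith
  · rw [hDl]
    linear_combination 2 * hl2
  · rw [hDr]
    linear_combination -2 * hr2
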